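/- Let d ≥ 3 be an integer. Then F(x) > 0 for all x ∈ ℝ^d \ {0}, and ∫_{ℝ^d} (1 + |x|^{−1}) F(x) dx < +∞. -/

import Mathlib

open MeasureTheory Metric Set Filter
open scoped RealInnerProductSpace Topology ENNReal

noncomputable section

/-- The modified Bessel function of the second kind of order `α`:
`K_α(t) = ∫_0^∞ exp (-t cosh r) cosh (α r) dr`. -/
def besselK (α t : ℝ) : ℝ :=
  ∫ r in Set.Ioi (0:ℝ), Real.exp (-t * Real.cosh r) * Real.cosh (α * r)

/-- `G(x) = (2π)^{-d/2} |x|^{1-d/2} K_{d/2-1}(|x|)`. -/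
def Gfun (d : ℕ) (x : EuclideanSpace ℝ (Fin d)) : ℝ :=
  (2 * Real.pi) ^ (-(d:ℝ)/2) * ‖x‖ ^ (1 - (d:ℝ)/2) * besselK ((d:ℝ)/2 - 1) ‖x‖

/-- `H(x) = (2π)^{-d/2} |x|^{1-d/2} K'_{d/2-1}(|x|)`. -/
def Hfun (d : ℕ) (x : EuclideanSpace ℝ (Fin d)) : ℝ :=
  (2 * Real.pi) ^ (-(d:ℝ)/2) * ‖x‖ ^ (1 - (d:ℝ)/2) * deriv (besselK ((d:ℝ)/2 - 1)) ‖x‖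

/-- `W(x) = (2π)^{-d/2} ∫_{|x|}^∞ t^{d/2-1} K_{d/2-1}(t) dt`. -/
def Wfun (d : ℕ) (x : EuclideanSpace ℝ (Fin d)) : ℝ :=
  (2 * Real.pi) ^ (-(d:ℝ)/2) * ∫ t in Set.Ioi ‖x‖, t ^ ((d:ℝ)/2 - 1) * besselK ((d:ℝ)/2 - 1) t

/-- `F(x) = (1 - d/2) G(x)/|x| - H(x)`. -/
def Ffun (d : ℕ) (x : EuclideanSpace ℝ (Fin d)) : ℝ :=
  (1 - (d:ℝ)/2) * Gfun d x / ‖x‖ - Hfun d x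

/-- The Bessel potential `G_a(x) = a^{d-2} G(ax)`. -/
def Ga (d : ℕ) (a : ℝ) (x : EuclideanSpace ℝ (Fin d)) : ℝ := a ^ ((d:ℝ) - 2) * Gfun d (a • x)

/-- `H_a(x) = a^{d-2} H(ax)`. -/
def Ha (d : ℕ) (a : ℝ) (x : EuclideanSpace ℝ (Fin d)) : ℝ := a ^ ((d:ℝ) - 2) * Hfun d (a • x)

/-- `W_a(x) = W(ax)`. -/
def Wa (d : ℕ) (a : ℝ) (x : EuclideanSpace ℝ (Fin d)) : ℝ := Wfun d (a • x)

/-- `F_a(x) = a^d F(ax)`. -/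
def Fa (d : ℕ) (a : ℝ) (x : EuclideanSpace ℝ (Fin d)) : ℝ := a ^ (d:ℝ) * Ffun d (a • x)

/-- `Ω ⊂ ℝ^d` is a bounded domain (open, connected, bounded) with `C²` boundary:
near every boundary point, `Ω` and `∂Ω` are the sublevel/level set of a `C²` defining
function with nonvanishing differential. -/
def IsBoundedC2Domain {d : ℕ} (Ω : Set (EuclideanSpace ℝ (Fin d))) : Prop :=
  IsOpen Ω ∧ IsConnected Ω ∧ Bornology.IsBounded Ω ∧
    ∀ x ∈ frontier Ω, ∃ (U : Set (EuclideanSpace ℝ (Fin d))) (f : EuclideanSpace ℝ (Fin d) → ℝ),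
      IsOpen U ∧ x ∈ U ∧ ContDiff ℝ 2 f ∧ (∀ y ∈ U, fderiv ℝ f y ≠ 0) ∧
      Ω ∩ U = {y ∈ U | f y < 0} ∧ frontier Ω ∩ U = {y ∈ U | f y = 0}

/-- `ν` is the outward unit normal vector field on `∂Ω`. -/
def IsOutwardUnitNormal {d : ℕ} (Ω : Set (EuclideanSpace ℝ (Fin d)))
    (ν : EuclideanSpace ℝ (Fin d) → EuclideanSpace ℝ (Fin d)) : Prop :=
  ∀ x ∈ frontier Ω, ‖ν x‖ = 1 ∧
    ∃ ε > 0, ∀ t : ℝ, t ∈ Set.Ioo 0 ε → x + t • ν x ∉ closure Ω ∧ x - t • ν x ∈ Ω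

/-- `Ω` is an (open) ball. -/
def IsBall {d : ℕ} (Ω : Set (EuclideanSpace ℝ (Fin d))) : Prop :=
  ∃ (c : EuclideanSpace ℝ (Fin d)) (r : ℝ), 0 < r ∧ Ω = Metric.ball c r

/-- `κ = (2π)^{-d/2} ∫_0^∞ t^{d/2-1} K_{d/2-1}(t) dt`. -/
def kappa (d : ℕ) : ℝ :=
  (2 * Real.pi) ^ (-(d:ℝ)/2) * ∫ t in Set.Ioi (0:ℝ), t ^ ((d:ℝ)/2 - 1) * besselK ((d:ℝ)/2 - 1) t

/-- `κ̃ = ∫_{S^{d-1}} |x - e|^{3-d} dσ(x)`. -/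
def sphereInt (d : ℕ) (e : EuclideanSpace ℝ (Fin d)) : ℝ :=
  ∫ x in Metric.sphere (0 : EuclideanSpace ℝ (Fin d)) 1, ‖x - e‖ ^ ((3:ℝ) - d) ∂μH[(d:ℝ)-1]

/-- The double boundary integral `∫_{∂Ω}∫_{∂Ω} |ν(x)-ν(y)|²/|x-y|^{d-1} dσ(x) dσ(y)`. -/
def nuSqInt (d : ℕ) (Ω : Set (EuclideanSpace ℝ (Fin d)))
    (ν : EuclideanSpace ℝ (Fin d) → EuclideanSpace ℝ (Fin d)) : ℝ :=
  ∫ x in frontier Ω, (∫ y in frontier Ω,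
      ‖ν x - ν y‖ ^ 2 / ‖x - y‖ ^ ((d:ℝ) - 1) ∂μH[(d:ℝ)-1]) ∂μH[(d:ℝ)-1]

/-- The nonlocal perimeter `Λ(Ω,a) = ∫_{Ω^c}∫_Ω G_a(x-y) dx dy`. -/
def Lam (d : ℕ) (Ω : Set (EuclideanSpace ℝ (Fin d))) (a : ℝ) : ℝ :=
  ∫ x in Ωᶜ, ∫ y in Ω, Ga d a (x - y)

/-- `Φ(Ω,a)`, written in terms of `W_a` and `F_a`. -/
def Phi (d : ℕ) (Ω : Set (EuclideanSpace ℝ (Fin d)))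
    (ν : EuclideanSpace ℝ (Fin d) → EuclideanSpace ℝ (Fin d)) (a : ℝ) : ℝ :=
  (∫ x in frontier Ω, (∫ y in frontier Ω,
      Wa d a (x - y) * ‖ν x - ν y‖ ^ 2 / ‖x - y‖ ^ ((d:ℝ) - 1) ∂μH[(d:ℝ)-1]) ∂μH[(d:ℝ)-1])
  + 4 * ∫ x in Ωᶜ, ∫ y in Ω, Fa d a (x - y) / ‖x - y‖

lemma Real.cosh_le_exp_abs (x : ℝ) : Real.cosh x ≤ Real.exp |x| := by
  rw [← Real.cosh_abs, Real.cosh_eq]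
  have : Real.exp (-|x|) ≤ Real.exp |x| :=
    Real.exp_le_exp.2 (by linarith [abs_nonneg x])
  linarith

lemma Real.abs_sinh_le_exp_abs (x : ℝ) : |Real.sinh x| ≤ Real.exp |x| := by
  rw [Real.abs_sinh]
  exact (Real.sinh_lt_cosh _).le.trans (by simpa using Real.cosh_le_exp_abs |x|)

lemma Real.exp_le_two_mul_cosh (x : ℝ) : Real.exp x ≤ 2 * Real.cosh x := by
  rw [Real.cosh_eq]
  linarith [Real.exp_pos (-x)]

lemma integrableOn_exp_neg_mul_cosh_mul {t : ℝ} (ht : 0 < t) {g : ℝ → ℝ} (hg : Continuous g)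
    {b : ℝ} (hgb : ∀ r, 0 < r → |g r| ≤ Real.exp (b * r)) :
    IntegrableOn (fun r => Real.exp (-t * Real.cosh r) * g r) (Ioi 0) := by
  have hG : IntegrableOn
      (fun r : ℝ => Real.exp (2 * b ^ 2 / t) * Real.exp (-(t / 8) * r ^ 2)) (Ioi 0) :=
    ((integrable_exp_neg_mul_sq (by positivity)).const_mul _).integrableOn
  refine hG.mono' (by fun_prop) ?_
  filter_upwards [ae_restrict_mem measurableSet_Ioi] with r hr
  have hr : 0 < r := hr
  rw [norm_mul, Real.norm_eq_abs, Real.norm_eq_abs, Real.abs_exp]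
  refine (mul_le_mul_of_nonneg_left (hgb r hr) (Real.exp_pos _).le).trans ?_
  rw [← Real.exp_add, ← Real.exp_add, Real.exp_le_exp]
  have hcosh : r ^ 2 / 4 ≤ Real.cosh r := by
    linarith [Real.exp_le_two_mul_cosh r, Real.quadratic_le_exp_of_nonneg hr.le]
  have hsq : 2 * b ^ 2 / t + -(t / 8) * r ^ 2 - (-t * (r ^ 2 / 4) + b * r)
      = t / 8 * (r - 4 * b / t) ^ 2 := by
    field_simp
    ring
  have : 0 ≤ t / 8 * (r - 4 * b / t) ^ 2 := by positivity
  nlinarith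

lemma abs_cosh_mul_le (α : ℝ) {r : ℝ} (hr : 0 < r) :
    |Real.cosh (α * r)| ≤ Real.exp (|α| * r) := by
  rw [abs_of_pos (Real.cosh_pos _)]
  simpa [abs_mul, abs_of_pos hr] using Real.cosh_le_exp_abs (α * r)

lemma abs_sinh_mul_le (α : ℝ) {r : ℝ} (hr : 0 < r) :
    |Real.sinh (α * r)| ≤ Real.exp (|α| * r) := by
  simpa [abs_mul, abs_of_pos hr] using Real.abs_sinh_le_exp_abs (α * r)

lemma integrableOn_besselK_integrand (α : ℝ) {t : ℝ} (ht : 0 < t) :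
    IntegrableOn (fun r => Real.exp (-t * Real.cosh r) * Real.cosh (α * r)) (Ioi 0) :=
  integrableOn_exp_neg_mul_cosh_mul ht (by fun_prop) fun _ hr => abs_cosh_mul_le α hr

lemma integrableOn_exp_mul_cosh_mul_cosh (α : ℝ) {t : ℝ} (ht : 0 < t) :
    IntegrableOn (fun r => Real.exp (-t * Real.cosh r) * (Real.cosh r * Real.cosh (α * r)))
      (Ioi 0) := by
  refine integrableOn_exp_neg_mul_cosh_mul ht (b := 1 + |α|) (by fun_prop) fun r hr => ?_
  rw [abs_mul, add_mul, Real.exp_add]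
  have h1 := abs_cosh_mul_le 1 hr
  rw [one_mul, abs_one] at h1
  exact mul_le_mul h1 (abs_cosh_mul_le α hr) (abs_nonneg _) (Real.exp_pos _).le

lemma integrableOn_exp_mul_sinh_mul_sinh (α : ℝ) {t : ℝ} (ht : 0 < t) :
    IntegrableOn (fun r => Real.exp (-t * Real.cosh r) * (Real.sinh r * Real.sinh (α * r)))
      (Ioi 0) := by
  refine integrableOn_exp_neg_mul_cosh_mul ht (b := 1 + |α|) (by fun_prop) fun r hr => ?_
  rw [abs_mul, add_mul, Real.exp_add]
  have h1 := abs_sinh_mul_le 1 hr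
  rw [one_mul, abs_one] at h1
  exact mul_le_mul h1 (abs_sinh_mul_le α hr) (abs_nonneg _) (Real.exp_pos _).le

lemma besselK_pos (α : ℝ) {t : ℝ} (ht : 0 < t) : 0 < besselK α t := by
  have hpos : ∀ r, 0 < Real.exp (-t * Real.cosh r) * Real.cosh (α * r) :=
    fun r => mul_pos (Real.exp_pos _) (Real.cosh_pos _)
  rw [besselK, integral_pos_iff_support_of_nonneg (fun r => (hpos r).le)
    (integrableOn_besselK_integrand α ht)]
  have : Function.support (fun r => Real.exp (-t * Real.cosh r) * Real.cosh (α * r)) = univ :=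
    eq_univ_of_forall fun r => (hpos r).ne'
  rw [this]
  simp

lemma hasDerivAt_besselK (α : ℝ) {t : ℝ} (ht : 0 < t) :
    HasDerivAt (besselK α)
      (-∫ r in Ioi (0:ℝ), Real.exp (-t * Real.cosh r) * (Real.cosh r * Real.cosh (α * r))) t := by
  rw [← integral_neg]
  refine (hasDerivAt_integral_of_dominated_loc_of_deriv_le (s := Ioi (t / 2))
    (μ := volume.restrict (Ioi 0))
    (F := fun s r => Real.exp (-s * Real.cosh r) * Real.cosh (α * r))
    (bound := fun r => Real.exp (-(t / 2) * Real.cosh r) * (Real.cosh r * Real.cosh (α * r)))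
    (F' := fun s r => -(Real.exp (-s * Real.cosh r) * (Real.cosh r * Real.cosh (α * r))))
    (Ioi_mem_nhds (by linarith)) (Eventually.of_forall fun s => ?_)
    (integrableOn_besselK_integrand α ht) ?_ ?_
    (integrableOn_exp_mul_cosh_mul_cosh α (half_pos ht)) ?_).2
  · exact Continuous.aestronglyMeasurable (by fun_prop)
  · exact Continuous.aestronglyMeasurable (by fun_prop)
  · refine Eventually.of_forall fun r s hs => ?_
    have hc := Real.cosh_pos r
    have hc' := Real.cosh_pos (α * r)
    rw [norm_neg, Real.norm_of_nonneg (by positivity)]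
    have hs : t / 2 < s := hs
    gcongr
  · refine Eventually.of_forall fun r s _ => ?_
    convert! ((((hasDerivAt_id s).neg.mul_const (Real.cosh r)).exp).mul_const
      (Real.cosh (α * r))) using 1
    simp only [Pi.neg_apply, id]
    ring

lemma mul_besselK_eq (α : ℝ) {t : ℝ} (ht : 0 < t) :
    α * besselK α t =
      t * ∫ r in Ioi (0:ℝ), Real.exp (-t * Real.cosh r) * (Real.sinh r * Real.sinh (α * r)) := by
  have hderiv : ∀ r : ℝ, HasDerivAt (fun r => Real.exp (-t * Real.cosh r) * Real.sinh (α * r))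
      (α * (Real.exp (-t * Real.cosh r) * Real.cosh (α * r))
        - t * (Real.exp (-t * Real.cosh r) * (Real.sinh r * Real.sinh (α * r)))) r := fun r => by
    convert! ((Real.hasDerivAt_cosh r).const_mul (-t)).exp.mul
      (((hasDerivAt_id r).const_mul α).sinh) using 1
    simp only [id]
    ring
  have hint := ((integrableOn_besselK_integrand α ht).const_mul α).sub
    ((integrableOn_exp_mul_sinh_mul_sinh α ht).const_mul t)
  have hlim := tendsto_zero_of_hasDerivAt_of_integrableOn_Ioi (fun r _ => hderiv r) hint
    (integrableOn_exp_neg_mul_cosh_mul ht (by fun_prop) fun _ hr => abs_sinh_mul_le α hr)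
  have h := integral_Ioi_of_hasDerivAt_of_tendsto (hderiv 0).continuousAt.continuousWithinAt
    (fun r _ => hderiv r) hint hlim
  rw [integral_sub ((integrableOn_besselK_integrand α ht).const_mul α)
    ((integrableOn_exp_mul_sinh_mul_sinh α ht).const_mul t),
    integral_const_mul, integral_const_mul] at h
  simp only [mul_zero, Real.sinh_zero, sub_zero] at h
  exact sub_eq_zero.1 h

lemma neg_mul_besselK_div_sub_deriv (α : ℝ) {t : ℝ} (ht : 0 < t) :
    -α * besselK α t / t - deriv (besselK α) t = besselK (α - 1) t := by
  rw [(hasDerivAt_besselK α ht).deriv, neg_mul, mul_besselK_eq α ht, neg_div,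
    mul_div_cancel_left₀ _ ht.ne', neg_sub_neg, besselK,
    ← integral_sub (integrableOn_exp_mul_cosh_mul_cosh α ht)
      (integrableOn_exp_mul_sinh_mul_sinh α ht)]
  congr 1 with r
  rw [sub_mul, one_mul, Real.cosh_sub]
  ring

/-- Convergence of the Mellin transform of `besselK β` at `s > |β|`. -/
lemma integrableOn_rpow_mul_besselK {β s : ℝ} (hs : |β| < s) :
    IntegrableOn (fun t => t ^ (s - 1) * besselK β t) (Ioi 0) := by
  have hs0 : 0 < s := (abs_nonneg β).trans_lt hs
  set f : ℝ × ℝ → ℝ := fun p =>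
    p.1 ^ (s - 1) * (Real.exp (-p.1 * Real.cosh p.2) * Real.cosh (β * p.2))
  have hf : Integrable f ((volume.restrict (Ioi 0)).prod (volume.restrict (Ioi 0))) := by
    rw [integrable_prod_iff' (Measurable.aestronglyMeasurable (by fun_prop))]
    have hf_eq : ∀ r t, f (t, r) =
        t ^ (s - 1) * Real.exp (-Real.cosh r * t ^ (1:ℝ)) * Real.cosh (β * r) := fun r t => by
      simp only [f, Real.rpow_one]
      rw [show -t * Real.cosh r = -Real.cosh r * t by ring]
      ring
    refine ⟨Eventually.of_forall fun r => ?_, ?_⟩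
    · simp_rw [hf_eq r]
      exact (integrableOn_rpow_mul_exp_neg_mul_rpow (by linarith) one_pos
        (Real.cosh_pos r)).mul_const _
    · have hnorm : ∀ r, ∫ t in Ioi (0:ℝ), ‖f (t, r)‖ =
          (1 / Real.cosh r) ^ s * Real.Gamma s * Real.cosh (β * r) := fun r => by
        rw [← Real.integral_rpow_mul_exp_neg_mul_Ioi hs0 (Real.cosh_pos r), ← integral_mul_const]
        refine setIntegral_congr_fun measurableSet_Ioi fun t ht => ?_
        have ht : 0 < t := ht
        have := Real.cosh_pos (β * r)
        simp only [hf_eq, Real.rpow_one, neg_mul]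
        exact Real.norm_of_nonneg (by positivity)
      simp_rw [hnorm]
      have hG : IntegrableOn (fun r : ℝ => 2 ^ s * Real.Gamma s * Real.exp (-(s - |β|) * r))
          (Ioi 0) := (exp_neg_integrableOn_Ioi 0 (sub_pos.2 hs)).const_mul _
      refine hG.mono' (Measurable.aestronglyMeasurable (by fun_prop)) ?_
      filter_upwards [ae_restrict_mem measurableSet_Ioi] with r hr
      have hc := Real.cosh_pos r
      have hΓ := Real.Gamma_pos_of_pos hs0
      have hβ := abs_cosh_mul_le β hr
      rw [abs_of_pos (Real.cosh_pos _)] at hβ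
      rw [Real.norm_of_nonneg (by have := Real.cosh_pos (β * r); positivity)]
      have h1 : (1 / Real.cosh r) ^ s ≤ 2 ^ s * Real.exp (-s * r) := by
        rw [neg_mul, mul_comm s r, ← neg_mul, Real.exp_mul, ← Real.mul_rpow (by norm_num)
          (Real.exp_pos _).le]
        refine Real.rpow_le_rpow (by positivity) ?_ hs0.le
        rw [Real.exp_neg, ← div_eq_mul_inv, div_le_div_iff₀ hc (Real.exp_pos _)]
        linarith [Real.exp_le_two_mul_cosh r]
      calc (1 / Real.cosh r) ^ s * Real.Gamma s * Real.cosh (β * r)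
          ≤ 2 ^ s * Real.exp (-s * r) * Real.Gamma s * Real.exp (|β| * r) := by gcongr
        _ = 2 ^ s * Real.Gamma s * (Real.exp (-s * r) * Real.exp (|β| * r)) := by ring
        _ = 2 ^ s * Real.Gamma s * Real.exp (-(s - |β|) * r) := by
          rw [← Real.exp_add]
          ring_nf
  refine hf.integral_prod_left.congr (Eventually.of_forall fun t => ?_)
  simp only [f, besselK]
  exact integral_const_mul _ _

/-- The profile of `Ffun d` as a function of the radius. -/
lemma Ffun_eq (d : ℕ) {x : EuclideanSpace ℝ (Fin d)} (hx : x ≠ 0) :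
    Ffun d x = (2 * Real.pi) ^ (-(d:ℝ)/2) * ‖x‖ ^ (1 - (d:ℝ)/2) *
      besselK ((d:ℝ)/2 - 1 - 1) ‖x‖ := by
  rw [← neg_mul_besselK_div_sub_deriv _ (norm_pos_iff.2 hx), Ffun, Gfun, Hfun]
  ring

lemma integrable_Ffun (d : ℕ) (hd : 3 ≤ d) :
    Integrable (fun x : EuclideanSpace ℝ (Fin d) => (1 + ‖x‖⁻¹) * Ffun d x) := by
  have : Nontrivial (EuclideanSpace ℝ (Fin d)) :=
    Module.nontrivial_of_finrank_pos (R := ℝ) (by simp; omega)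
  have hd' : (3:ℝ) ≤ d := by exact_mod_cast hd
  set c : ℝ := (2 * Real.pi) ^ (-(d:ℝ)/2)
  set β : ℝ := (d:ℝ)/2 - 1 - 1 with hβ
  have hβd : |β| < (d:ℝ)/2 := by rw [abs_lt]; constructor <;> linarith
  have hf : Integrable (fun x : EuclideanSpace ℝ (Fin d) =>
      (fun t : ℝ => (1 + t⁻¹) * (c * t ^ (1 - (d:ℝ)/2) * besselK β t)) ‖x‖) := by
    rw [integrable_fun_norm_addHaar volume
      (f := fun t : ℝ => (1 + t⁻¹) * (c * t ^ (1 - (d:ℝ)/2) * besselK β t))]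
    refine (((integrableOn_rpow_mul_besselK (hβd.trans (lt_add_one _))).add
      (integrableOn_rpow_mul_besselK hβd)).const_mul c).congr ?_
    filter_upwards [ae_restrict_mem measurableSet_Ioi] with t ht
    have ht : 0 < t := ht
    have h1 : t ^ ((d:ℝ)/2 + 1 - 1) = t ^ (d - 1) * t ^ (1 - (d:ℝ)/2) := by
      rw [← Real.rpow_natCast, ← Real.rpow_add ht, Nat.cast_sub (by omega)]
      congr 1
      push_cast
      ring
    have h2 : t ^ ((d:ℝ)/2 - 1) = t ^ ((d:ℝ)/2 + 1 - 1) * t⁻¹ := by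
      rw [add_sub_cancel_right, Real.rpow_sub_one ht.ne', div_eq_mul_inv]
    simp only [Pi.add_apply, finrank_euclideanSpace_fin, smul_eq_mul]
    rw [h2, h1]
    ring
  refine hf.congr ?_
  filter_upwards [compl_mem_ae_iff.2 (measure_singleton (0 : EuclideanSpace ℝ (Fin d)))] with x hx
  simp only [Ffun_eq d hx, c, β]

/-- **Lemma 3.1 (ii).** For `d ≥ 3`, `F(x) > 0` for all `x ∈ ℝ^d \ {0}` and
`∫_{ℝ^d} (1 + |x|⁻¹) F(x) dx < +∞`. -/
theorem Ffun_pos_and_integrable (d : ℕ) (hd : 3 ≤ d) :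
    (∀ x : EuclideanSpace ℝ (Fin d), x ≠ 0 → 0 < Ffun d x) ∧
    Integrable (fun x : EuclideanSpace ℝ (Fin d) => (1 + ‖x‖⁻¹) * Ffun d x) := by
  refine ⟨fun x hx => ?_, integrable_Ffun d hd⟩
  have hx' := norm_pos_iff.2 hx
  rw [Ffun_eq d hx]
  exact mul_pos (by positivity) (besselK_pos _ hx')
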